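/- One-step drift of the critic error (appendix Lemma on critic-error drift, with corrected constant). Let ξ ∈ (0,1], 0 < α ≤ β, ε ∈ [0,1], and r_i : S×A → [0,1] for i = 0,…,N. Let λ ∈ [0, 2/(ξ(1−γ))]^N, let Q̂_i : S×A → [0, 1/(1−γ)] for i = 0,…,N, and fix a sample (s̄, ā, s̄', ā') ∈ S×A×S×A. Define the TD update Q̂'_i(s,a) = Q̂_i(s,a) + β·1{(s,a)=(s̄,ā)}·( r_i(s̄,ā) + γ·Q̂_i(s̄',ā') − Q̂_i(s̄,ā) ). Let θ' = θ + α·(Q̂_0 + ∑_{i=1}^N λ_i Q̂_i) for some θ : S×A → ℝ, let π̂ and π̂' be the ε-greedy softmax behavior policies π̂ = ε/|A| + (1−ε)·softmax(θ) and π̂' = ε/|A| + (1−ε)·softmax(θ') (softmax taken per state), and set z_i = Q̂_i − Q_i^{π̂} and z'_i = Q̂'_i − Q_i^{π̂'}. Then for every i = 0,…,N, ‖z'_i − z_i‖ ≤ 6·(|S||A|)^{3/2}·N·β / (ξ(1−γ)⁴). -/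

import Mathlib

open Finset

/-- `π` is a (Markov, stationary) policy: a probability distribution over actions per state. -/
def IsPolicy {S A : Type*} [Fintype A] (π : S → A → ℝ) : Prop :=
  (∀ s a, 0 ≤ π s a) ∧ ∀ s, ∑ a, π s a = 1

/-- `P` is a transition kernel. -/
def IsKernel {S A : Type*} [Fintype S] (P : S → A → S → ℝ) : Prop :=
  (∀ s a s', 0 ≤ P s a s') ∧ ∀ s a, ∑ s', P s a s' = 1

/-- `ρ` is a probability distribution on `S`. -/
def IsDist {S : Type*} [Fintype S] (ρ : S → ℝ) : Prop :=
  (∀ s, 0 ≤ ρ s) ∧ ∑ s, ρ s = 1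

/-- `Q` solves the Bellman equation `Q = r + γ P^π Q` for reward `r`, kernel `P`,
discount `γ` and policy `π` (for `γ ∈ (0,1)` the solution exists and is unique). -/
def IsBellman {S A : Type*} [Fintype S] [Fintype A]
    (P : S → A → S → ℝ) (γ : ℝ) (r : S → A → ℝ) (π : S → A → ℝ)
    (Q : S → A → ℝ) : Prop :=
  ∀ s a, Q s a = r s a + γ * ∑ s', P s a s' * ∑ a', π s' a' * Q s' a'

/-- The value `V^π(ρ) = ∑_s ρ(s) ∑_a π(a|s) Q(s,a)` computed from a `Q`-table. -/
def Vval {S A : Type*} [Fintype S] [Fintype A]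
    (ρ : S → ℝ) (π : S → A → ℝ) (Q : S → A → ℝ) : ℝ :=
  ∑ s, ρ s * ∑ a, π s a * Q s a

/-- Advantage computed from a `Q`-table: `A(s,a) = Q(s,a) − ∑_{a'} π(a'|s) Q(s,a')`. -/
def adv {S A : Type*} [Fintype A] (π : S → A → ℝ) (Q : S → A → ℝ)
    (s : S) (a : A) : ℝ :=
  Q s a - ∑ a', π s a' * Q s a'

/-- Euclidean norm of a table on `S × A` viewed as a vector in `ℝ^{|S||A|}`. -/
noncomputable def tnorm {S A : Type*} [Fintype S] [Fintype A] (f : S → A → ℝ) : ℝ :=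
  Real.sqrt (∑ s, ∑ a, (f s a) ^ 2)

/-- Sup norm of a table on `S × A`. -/
noncomputable def supnorm {S A : Type*} [Fintype S] [Fintype A] (f : S → A → ℝ) : ℝ :=
  ⨆ p : S × A, |f p.1 p.2|

/-- A fixed-point bound: if every uniform bound `K` on `|f|` improves to `b + γ K`, then
`|f| ≤ b / (1 - γ)`. -/
lemma abs_le_div_one_sub_of_contraction {S A : Type*} [Finite S] [Finite A]
    [Nonempty S] [Nonempty A] {f : S → A → ℝ} {b γ : ℝ} (hγ : γ < 1)
    (h : ∀ K, (∀ s a, |f s a| ≤ K) → ∀ s a, |f s a| ≤ b + γ * K) (s : S) (a : A) :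
    |f s a| ≤ b / (1 - γ) := by
  obtain ⟨p, hp⟩ := Finite.exists_max (fun p : S × A => |f p.1 p.2|)
  have hK : ∀ s a, |f s a| ≤ |f p.1 p.2| := fun s a => hp (s, a)
  have h1 := h _ hK p.1 p.2
  refine (hK s a).trans ?_
  rw [le_div_iff₀ (by linarith)]
  linarith

/-- An average of values bounded by `K` in absolute value is bounded by `K`. -/
lemma abs_sum_mul_le_of_weights {ι : Type*} [Fintype ι] {w f : ι → ℝ} {K : ℝ}
    (hw : ∀ i, 0 ≤ w i) (hw1 : ∑ i, w i = 1) (hf : ∀ i, |f i| ≤ K) :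
    |∑ i, w i * f i| ≤ K := by
  calc |∑ i, w i * f i| ≤ ∑ i, |w i * f i| := abs_sum_le_sum_abs _ _
    _ ≤ ∑ i, w i * K := by
      refine sum_le_sum fun i _ => ?_
      rw [abs_mul, abs_of_nonneg (hw i)]
      exact mul_le_mul_of_nonneg_left (hf i) (hw i)
    _ = K := by rw [← sum_mul, hw1, one_mul]

/-- If two probability vectors dominate each other up to the factor `1 - M`, their averages of
a function bounded by `c` differ by at most `2 M c`. -/
lemma abs_sum_sub_mul_le_of_dominated {ι : Type*} [Fintype ι] {p q f : ι → ℝ} {M c : ℝ}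
    (hp : ∀ i, 0 ≤ p i) (hp1 : ∑ i, p i = 1) (hq : ∀ i, 0 ≤ q i) (hq1 : ∑ i, q i = 1)
    (hpq : ∀ i, (1 - M) * p i ≤ q i) (hqp : ∀ i, (1 - M) * q i ≤ p i) (hM : 0 ≤ M)
    (hf : ∀ i, |f i| ≤ c) :
    |∑ i, (q i - p i) * f i| ≤ 2 * M * c := by
  have key : ∀ u v : ι → ℝ, (∀ i, 0 ≤ u i) → ∑ i, u i = 1 → ∑ i, v i = 1 →
      (∀ i, (1 - M) * u i ≤ v i) → ∑ i, u i * f i - ∑ i, v i * f i ≤ 2 * M * c := by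
    intro u v hu hu1 hv1 huv
    have h1 : ∑ i, (1 - M) * u i * (f i + c) ≤ ∑ i, v i * (f i + c) :=
      sum_le_sum fun i _ => mul_le_mul_of_nonneg_right (huv i)
        (by linarith [neg_abs_le (f i), hf i])
    simp only [mul_add, sum_add_distrib, ← sum_mul, ← mul_sum, hu1, hv1, mul_assoc] at h1
    have h2 := (abs_le.1 (abs_sum_mul_le_of_weights hu hu1 hf)).2
    nlinarith [mul_le_mul_of_nonneg_left h2 hM]
  have e : ∑ i, (q i - p i) * f i = ∑ i, q i * f i - ∑ i, p i * f i := by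
    simp only [sub_mul, sum_sub_distrib]
  rw [e, abs_le]
  exact ⟨by linarith [key p q hp hp1 hq1 hpq], key q p hq hq1 hp1 hqp⟩

/-- A bounded one-sided change of the logits changes the softmax by a bounded factor. -/
lemma one_sub_mul_softmax_le {A : Type*} [Fintype A] [Nonempty A] {x y : A → ℝ} {u v : ℝ}
    (hu : ∀ a, x a ≤ y a + u) (hv : ∀ a, y a ≤ x a + v) (a : A) :
    (1 - (u + v)) * (Real.exp (x a) / ∑ b, Real.exp (x b)) ≤
      Real.exp (y a) / ∑ b, Real.exp (y b) := by
  have hX : 0 < ∑ b, Real.exp (x b) := sum_pos (fun _ _ => Real.exp_pos _) univ_nonempty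
  have hY : 0 < ∑ b, Real.exp (y b) := sum_pos (fun _ _ => Real.exp_pos _) univ_nonempty
  have hsum : ∑ b, Real.exp (y b) ≤ Real.exp v * ∑ b, Real.exp (x b) := by
    rw [mul_sum]
    refine sum_le_sum fun b _ => ?_
    rw [← Real.exp_add]
    exact Real.exp_le_exp.2 (by linarith [hv b])
  have h1 : 1 - (u + v) ≤ Real.exp (-(u + v)) := by
    linarith [Real.add_one_le_exp (-(u + v))]
  calc (1 - (u + v)) * (Real.exp (x a) / ∑ b, Real.exp (x b))
      ≤ Real.exp (-(u + v)) * (Real.exp (x a) / ∑ b, Real.exp (x b)) := by gcongr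
    _ = Real.exp (x a - u) / (Real.exp v * ∑ b, Real.exp (x b)) := by
      rw [neg_add, Real.exp_add, Real.exp_sub, Real.exp_neg, Real.exp_neg]
      field_simp
    _ ≤ Real.exp (y a) / ∑ b, Real.exp (y b) := by
      gcongr
      linarith [hu a]

/-- Mixing softmax with the uniform distribution gives a policy. -/
lemma isPolicy_uniform_mix_softmax {S A : Type*} [Fintype A] [Nonempty A]
    {ε : ℝ} (hε : ε ∈ Set.Icc (0:ℝ) 1) {θ π : S → A → ℝ}
    (hπ : ∀ s a, π s a = ε / (Fintype.card A : ℝ)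
      + (1-ε) * (Real.exp (θ s a) / ∑ a', Real.exp (θ s a'))) : IsPolicy π := by
  have h1 : 0 ≤ 1 - ε := by linarith [hε.2]
  have h0 := hε.1
  constructor
  · intro s a
    rw [hπ]
    positivity
  · intro s
    have hX : 0 < ∑ b, Real.exp (θ s b) := sum_pos (fun _ _ => Real.exp_pos _) univ_nonempty
    have hA : (Fintype.card A : ℝ) ≠ 0 := by simp
    simp only [hπ, sum_add_distrib, ← mul_sum, ← sum_div, sum_const, card_univ, nsmul_eq_mul]
    field_simp
    ring

/-- One-step lookahead under a kernel and a policy does not increase a uniform bound. -/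
lemma abs_bellman_average_le {S A : Type*} [Fintype S] [Fintype A] {P : S → A → S → ℝ}
    (hP : IsKernel P) {f : S → ℝ} {K : ℝ} (hf : ∀ s, |f s| ≤ K) (s : S) (a : A) :
    |∑ s', P s a s' * f s'| ≤ K :=
  abs_sum_mul_le_of_weights (hP.1 s a) (hP.2 s a) hf

/-- The solution of the Bellman equation with rewards in `[0, 1]` is bounded by `1 / (1 - γ)`. -/
lemma IsBellman.abs_le {S A : Type*} [Fintype S] [Fintype A] [Nonempty S] [Nonempty A]
    {P : S → A → S → ℝ} {γ : ℝ} {r π Q : S → A → ℝ} (hQ : IsBellman P γ r π Q)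
    (hP : IsKernel P) (hπ : IsPolicy π) (hγ : γ ∈ Set.Ioo (0:ℝ) 1)
    (hr : ∀ s a, r s a ∈ Set.Icc (0:ℝ) 1) (s : S) (a : A) : |Q s a| ≤ 1 / (1 - γ) := by
  refine abs_le_div_one_sub_of_contraction hγ.2 (fun K hK s a => ?_) s a
  have h1 := abs_bellman_average_le hP
    (fun s' => abs_sum_mul_le_of_weights (hπ.1 s') (hπ.2 s') (hK s')) s a
  rw [hQ s a]
  refine (abs_add_le _ _).trans (add_le_add ?_ ?_)
  · rw [abs_of_nonneg (hr s a).1]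
    exact (hr s a).2
  · rw [abs_mul, abs_of_pos hγ.1]
    exact mul_le_mul_of_nonneg_left h1 hγ.1.le

/-- Sensitivity of the Bellman solution to the policy. -/
lemma IsBellman.abs_sub_le {S A : Type*} [Fintype S] [Fintype A] [Nonempty S] [Nonempty A]
    {P : S → A → S → ℝ} {γ δ : ℝ} {r π π' Q Q' : S → A → ℝ} (hQ : IsBellman P γ r π Q)
    (hQ' : IsBellman P γ r π' Q') (hP : IsKernel P) (hπ' : IsPolicy π')
    (hγ : γ ∈ Set.Ioo (0:ℝ) 1) (hδ : ∀ s, |∑ a, (π' s a - π s a) * Q s a| ≤ δ)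
    (s : S) (a : A) : |Q' s a - Q s a| ≤ γ * δ / (1 - γ) := by
  refine abs_le_div_one_sub_of_contraction (f := fun s a => Q' s a - Q s a) hγ.2
    (fun K hK s a => ?_) s a
  have e : Q' s a - Q s a = γ * ∑ s', P s a s' *
      (∑ a', π' s' a' * (Q' s' a' - Q s' a') + ∑ a', (π' s' a' - π s' a') * Q s' a') := by
    rw [hQ s a, hQ' s a, add_sub_add_left_eq_sub, ← mul_sub, ← sum_sub_distrib]
    congr 1
    refine sum_congr rfl fun s' _ => ?_
    rw [← mul_sub, ← sum_sub_distrib, ← sum_add_distrib]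
    congr 1
    exact sum_congr rfl fun a' _ => by ring
  have h1 := abs_bellman_average_le hP (fun s' => (abs_add_le _ _).trans
    (add_le_add (abs_sum_mul_le_of_weights (hπ'.1 s') (hπ'.2 s') (hK s')) (hδ s'))) s a
  show |Q' s a - Q s a| ≤ _
  rw [e, abs_mul, abs_of_pos hγ.1]
  linarith [mul_le_mul_of_nonneg_left h1 hγ.1.le]

/-- The Euclidean norm of a table is at most `√(|S||A|)` times a uniform bound. -/
lemma tnorm_le_of_abs_le {S A : Type*} [Fintype S] [Fintype A] {f : S → A → ℝ} {B : ℝ}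
    (hB : 0 ≤ B) (hf : ∀ s a, |f s a| ≤ B) :
    tnorm f ≤ √((Fintype.card S : ℝ) * Fintype.card A) * B := by
  rw [tnorm]
  refine Real.sqrt_le_iff.2 ⟨by positivity, ?_⟩
  rw [mul_pow, Real.sq_sqrt (by positivity)]
  calc ∑ s, ∑ a, (f s a) ^ 2 ≤ ∑ _s : S, ∑ _a : A, B ^ 2 :=
        sum_le_sum fun s _ => sum_le_sum fun a _ => sq_le_sq' (abs_le.1 (hf s a)).1
          (abs_le.1 (hf s a)).2
    _ = _ := by simp [mul_assoc]

/-- one-step drift of the critic error `z_i = Q̂_i − Q_i^{π̂}` under one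
TD update of the critic and one natural actor update (corrected constant). -/
theorem critic_error_one_step_drift
    {S A : Type*} [Fintype S] [Fintype A] [Nonempty S] [Nonempty A]
    [DecidableEq S] [DecidableEq A]
    (N : ℕ) (hN : 1 ≤ N)
    (P : S → A → S → ℝ) (hP : IsKernel P)
    (γ : ℝ) (hγ : γ ∈ Set.Ioo (0:ℝ) 1)
    (ξ : ℝ) (hξ : ξ ∈ Set.Ioc (0:ℝ) 1)
    (α β : ℝ) (hα : 0 < α) (hαβ : α ≤ β)
    (ε : ℝ) (hε : ε ∈ Set.Icc (0:ℝ) 1)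
    (r : Fin (N+1) → S → A → ℝ) (hr : ∀ i s a, r i s a ∈ Set.Icc (0:ℝ) 1)
    (lam : Fin N → ℝ) (hlam : ∀ i, lam i ∈ Set.Icc (0:ℝ) (2/(ξ*(1-γ))))
    (Qh : Fin (N+1) → S → A → ℝ)
    (hQh : ∀ i s a, Qh i s a ∈ Set.Icc (0:ℝ) (1/(1-γ)))
    (sb : S) (ab : A) (sb' : S) (ab' : A)
    (Qh' : Fin (N+1) → S → A → ℝ)
    (hQh' : ∀ i s a, Qh' i s a = Qh i s a +
      β * (if (s, a) = (sb, ab) then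
        r i sb ab + γ * Qh i sb' ab' - Qh i sb ab else 0))
    (θ θ' : S → A → ℝ)
    (hθ' : ∀ s a, θ' s a = θ s a +
      α * (Qh 0 s a + ∑ i : Fin N, lam i * Qh i.succ s a))
    (πh πh' : S → A → ℝ)
    (hπh : ∀ s a, πh s a = ε / (Fintype.card A : ℝ)
      + (1-ε) * (Real.exp (θ s a) / ∑ a', Real.exp (θ s a')))
    (hπh' : ∀ s a, πh' s a = ε / (Fintype.card A : ℝ)
      + (1-ε) * (Real.exp (θ' s a) / ∑ a', Real.exp (θ' s a')))
    (Qb Qb' : Fin (N+1) → S → A → ℝ)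
    (hQb : ∀ i, IsBellman P γ (r i) πh (Qb i))
    (hQb' : ∀ i, IsBellman P γ (r i) πh' (Qb' i)) :
    ∀ i, tnorm (fun s a => (Qh' i s a - Qb' i s a) - (Qh i s a - Qb i s a))
      ≤ 6 * ((Fintype.card S : ℝ) * (Fintype.card A : ℝ)) ^ ((3:ℝ)/2) * N * β /
          (ξ * (1-γ)^4) := by
  intro i
  obtain ⟨hγ0, hγ1⟩ := hγ
  obtain ⟨hξ0, hξ1⟩ := hξ
  have hg : 0 < 1 - γ := by linarith
  have hβ : 0 < β := hα.trans_le hαβ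
  have hN1 : (1:ℝ) ≤ N := by exact_mod_cast hN
  have hc1 : 1 ≤ 1 / (1 - γ) := by rw [le_div_iff₀ hg]; linarith
  have hx1 : 1 ≤ 1 / ξ := by rw [le_div_iff₀ hξ0]; linarith
  set c := 1 / (1 - γ) with hc
  set x := 1 / ξ with hx
  have hcg : (1 - γ) * c = 1 := by rw [hc]; field_simp
  have hlamx : 2 / (ξ * (1 - γ)) = 2 * x * c := by rw [hc, hx]; field_simp
  rw [hlamx] at hlam
  have hNx : 1 ≤ N * x := one_le_mul_of_one_le_of_one_le hN1 hx1
  have hd : ∀ s a, 0 ≤ Qh 0 s a + ∑ j : Fin N, lam j * Qh j.succ s a ∧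
      Qh 0 s a + ∑ j : Fin N, lam j * Qh j.succ s a ≤ 3 * N * x * c ^ 2 := by
    intro s a
    have hs : ∑ j : Fin N, lam j * Qh j.succ s a ≤ ∑ _j : Fin N, 2 * x * c * c :=
      sum_le_sum fun j _ => mul_le_mul (hlam j).2 (hQh _ s a).2 (hQh _ s a).1 (by positivity)
    rw [sum_const, card_univ, Fintype.card_fin, nsmul_eq_mul] at hs
    have hs0 : 0 ≤ ∑ j : Fin N, lam j * Qh j.succ s a :=
      sum_nonneg fun j _ => mul_nonneg (hlam j).1 (hQh _ s a).1
    refine ⟨add_nonneg (hQh 0 s a).1 hs0, ?_⟩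
    have h1 : c ≤ N * x * c ^ 2 := by
      calc c ≤ c ^ 2 := by nlinarith
        _ ≤ N * x * c ^ 2 := le_mul_of_one_le_left (by positivity) hNx
    linarith [(hQh 0 s a).2]
  set M := β * (3 * N * x * c ^ 2) with hM
  have hM0 : 0 ≤ M := by positivity
  have hlow : ∀ s a, θ s a ≤ θ' s a := fun s a => by
    rw [hθ']
    linarith [mul_nonneg hα.le (hd s a).1]
  have hup : ∀ s a, θ' s a ≤ θ s a + M := fun s a => by
    rw [hθ']
    linarith [mul_le_mul hαβ (hd s a).2 (hd s a).1 hβ.le]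
  have hpol := isPolicy_uniform_mix_softmax hε hπh
  have hpol' := isPolicy_uniform_mix_softmax hε hπh'
  have h1ε : 0 ≤ 1 - ε := by linarith [hε.2]
  have hεA : 0 ≤ M * (ε / (Fintype.card A : ℝ)) :=
    mul_nonneg hM0 (div_nonneg hε.1 (Nat.cast_nonneg _))
  have hdom : ∀ s a, (1 - M) * πh s a ≤ πh' s a := fun s a => by
    have h := one_sub_mul_softmax_le (x := θ s) (y := θ' s) (u := 0) (v := M)
      (fun b => by linarith [hlow s b]) (hup s) a
    rw [zero_add] at h
    rw [hπh, hπh']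
    linarith [mul_le_mul_of_nonneg_left h h1ε]
  have hdom' : ∀ s a, (1 - M) * πh' s a ≤ πh s a := fun s a => by
    have h := one_sub_mul_softmax_le (x := θ' s) (y := θ s) (u := M) (v := 0)
      (hup s) (fun b => by linarith [hlow s b]) a
    rw [add_zero] at h
    rw [hπh, hπh']
    linarith [mul_le_mul_of_nonneg_left h h1ε]
  have hδ : ∀ s, |∑ a, (πh' s a - πh s a) * Qb i s a| ≤ 2 * M * c := fun s =>
    abs_sum_sub_mul_le_of_dominated (hpol.1 s) (hpol.2 s) (hpol'.1 s) (hpol'.2 s)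
      (hdom s) (hdom' s) hM0 ((hQb i).abs_le hP hpol ⟨hγ0, hγ1⟩ (hr i) s)
  have hdiff := (hQb i).abs_sub_le (hQb' i) hP hpol' ⟨hγ0, hγ1⟩ hδ
  have hTD : ∀ s a, |Qh' i s a - Qh i s a| ≤ β * c := by
    intro s a
    rw [hQh', add_sub_cancel_left, abs_mul, abs_of_pos hβ]
    refine mul_le_mul_of_nonneg_left ?_ hβ.le
    split_ifs
    · have h1 := hr i sb ab
      have h2 := hQh i sb ab
      have h3 := hQh i sb' ab'
      have h4 := mul_nonneg hγ0.le h3.1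
      have h5 := mul_le_mul_of_nonneg_left h3.2 hγ0.le
      rw [abs_le]
      constructor <;> linarith [h1.1, h1.2, h2.1, h2.2]
    · rw [abs_zero]; linarith
  have hbound : ∀ s a, |(Qh' i s a - Qb' i s a) - (Qh i s a - Qb i s a)| ≤
      6 * N * β * x * c ^ 4 := by
    intro s a
    have e : (Qh' i s a - Qb' i s a) - (Qh i s a - Qb i s a) =
        (Qh' i s a - Qh i s a) - (Qb' i s a - Qb i s a) := by ring
    rw [e]
    refine (abs_sub _ _).trans ((add_le_add (hTD s a) (hdiff s a)).trans ?_)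
    have e1 : γ * (2 * M * c) / (1 - γ) = 6 * N * β * x * c ^ 4 - 6 * N * β * x * c ^ 3 := by
      have e2 : γ * (2 * M * c) / (1 - γ) = γ * (2 * M * c) * c := by rw [hc]; ring
      rw [e2, hM]
      linear_combination (-6 * N * β * x * c ^ 3) * hcg
    rw [e1]
    have h1 : β * c ≤ 6 * N * β * x * c ^ 3 := by
      calc β * c ≤ (N * x) * (β * c) := le_mul_of_one_le_left (by positivity) hNx
        _ ≤ (N * x) * (β * c) * (6 * c ^ 2) :=
          le_mul_of_one_le_right (by positivity) (by nlinarith)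
        _ = _ := by ring
    linarith
  refine (tnorm_le_of_abs_le (by positivity) hbound).trans ?_
  have hn : (1:ℝ) ≤ (Fintype.card S : ℝ) * Fintype.card A := by
    exact_mod_cast Nat.one_le_iff_ne_zero.2 (mul_ne_zero Fintype.card_ne_zero Fintype.card_ne_zero)
  have hpow : √((Fintype.card S : ℝ) * Fintype.card A) ≤
      ((Fintype.card S : ℝ) * Fintype.card A) ^ ((3:ℝ)/2) := by
    rw [Real.sqrt_eq_rpow]
    exact Real.rpow_le_rpow_of_exponent_le hn (by norm_num)
  refine (mul_le_mul_of_nonneg_right hpow (by positivity)).trans_eq ?_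
  rw [hc, hx]
  field_simp
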